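/- arXiv:2009.11236 — 5 statements merged into one kernel-verified Lean document; each statement's English description precedes it below -/
import Mathlib

section
/- Let j, k, l, m be nonzero integers with j - k + l - m = 0, j ≠ k and j ≠ m. Let j₁* ≥ j₂* ≥ j₃* ≥ j₄* denote the decreasing rearrangement of the four absolute values |j|, |k|, |l|, |m|. Then |j² - k² + l² - m²| ≥ (j₁*)^(3/2) / (2 · (j₂* · j₃* · j₄*)^(1/2)). -/
theorem pow_three_le_of_le_add {x p q b c d : ℤ} (hx : 0 ≤ x) (hp : 1 ≤ p) (hq : 1 ≤ q)
    (hb : 1 ≤ b) (hc : 1 ≤ c) (hd : 1 ≤ d) (hxb : x ≤ p + b) (hxc : x ≤ q + c)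
    (hxd : x ≤ p + q + d) : x ^ 3 ≤ 16 * (p * q) ^ 2 * (b * d * c) := by
  have h1 : x ≤ 2 * (p * b) := by nlinarith
  have h2 : x ≤ 2 * (q * c) := by nlinarith
  have hpq : p + q ≤ p * q + 1 := by nlinarith
  have hpq1 : 1 ≤ p * q := by nlinarith
  have h3 : x ≤ 4 * (p * q * d) := by nlinarith
  calc x ^ 3 = x * x * x := by ring
    _ ≤ 2 * (p * b) * (2 * (q * c)) * (4 * (p * q * d)) := by gcongr
    _ = 16 * (p * q) ^ 2 * (b * d * c) := by ring

theorem abs_pow_three_le_resonance {j k l m : ℤ} (hk : k ≠ 0) (hl : l ≠ 0) (hm : m ≠ 0)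
    (hmom : j - k + l - m = 0) (hjk : j ≠ k) (hjm : j ≠ m) :
    |j| ^ 3 ≤ 4 * (j ^ 2 - k ^ 2 + l ^ 2 - m ^ 2) ^ 2 * (|k| * |l| * |m|) := by
  obtain rfl : l = k + m - j := by linarith
  have hfac : 4 * (j ^ 2 - k ^ 2 + (k + m - j) ^ 2 - m ^ 2) ^ 2
      = 16 * (|j - k| * |j - m|) ^ 2 := by
    rw [mul_pow, sq_abs, sq_abs]
    ring
  rw [hfac]
  apply pow_three_le_of_le_add (abs_nonneg j) (Int.one_le_abs (sub_ne_zero.2 hjk))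
    (Int.one_le_abs (sub_ne_zero.2 hjm)) (Int.one_le_abs hk) (Int.one_le_abs hm)
    (Int.one_le_abs hl) <;> grind


/-- Lemma 2.1: lower bound on |j² - k² + l² - m²| for non-resonant indices.
The decreasing rearrangement j₁* ≥ j₂* ≥ j₃* ≥ j₄* of the absolute values
|j|, |k|, |l|, |m| is encoded by a sorted list that is a permutation of them. -/
theorem stmt_0 (j k l m : ℤ) (hj : j ≠ 0) (hk : k ≠ 0) (hl : l ≠ 0) (hm : m ≠ 0)
    (hmom : j - k + l - m = 0) (hjk : j ≠ k) (hjm : j ≠ m)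
    (a₁ a₂ a₃ a₄ : ℤ)
    (hperm : [a₁, a₂, a₃, a₄].Perm [|j|, |k|, |l|, |m|])
    (h12 : a₂ ≤ a₁) (h23 : a₃ ≤ a₂) (h34 : a₄ ≤ a₃) :
    ((|j ^ 2 - k ^ 2 + l ^ 2 - m ^ 2| : ℤ) : ℝ) ≥
      (Real.sqrt (a₁ : ℝ)) ^ 3 / (2 * Real.sqrt ((a₂ : ℝ) * (a₃ : ℝ) * (a₄ : ℝ))) := by
  have hprod : a₁ * (a₂ * a₃ * a₄) = |j| * |k| * |l| * |m| := by
    have h := hperm.prod_eq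
    simp only [List.prod_cons, List.prod_nil, mul_one] at h
    linear_combination h
  have hmem : ∀ x ∈ [a₁, a₂, a₃, a₄], 0 < x := by
    intro x hx
    have hx' := hperm.mem_iff.1 hx
    simp only [List.mem_cons, List.not_mem_nil, or_false] at hx'
    rcases hx' with rfl | rfl | rfl | rfl <;> simpa
  have ha₁ : 0 < a₁ := hmem a₁ (by simp)
  have ha₂ : 0 < a₂ := hmem a₂ (by simp)
  have ha₃ : 0 < a₃ := hmem a₃ (by simp)
  have ha₄ : 0 < a₄ := hmem a₄ (by simp)
  have key : a₁ ^ 3 ≤ 4 * (j ^ 2 - k ^ 2 + l ^ 2 - m ^ 2) ^ 2 * (a₂ * a₃ * a₄) := by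
    have h₁ : a₁ ∈ [|j|, |k|, |l|, |m|] := hperm.mem_iff.1 (by simp)
    simp only [List.mem_cons, List.not_mem_nil, or_false] at h₁
    rcases h₁ with h | h | h | h
    · have hrest : a₂ * a₃ * a₄ = |k| * |l| * |m| :=
        mul_left_cancel₀ ha₁.ne' (by rw [hprod, h]; ring)
      rw [hrest, h]
      exact abs_pow_three_le_resonance hk hl hm hmom hjk hjm
    · have hrest : a₂ * a₃ * a₄ = |j| * |m| * |l| :=
        mul_left_cancel₀ ha₁.ne' (by rw [hprod, h]; ring)
      rw [hrest, h]
      refine (abs_pow_three_le_resonance (j := k) hj hm hl (by lia) (by lia) (by lia)).trans_eq ?_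
      ring
    · have hrest : a₂ * a₃ * a₄ = |k| * |j| * |m| :=
        mul_left_cancel₀ ha₁.ne' (by rw [hprod, h]; ring)
      rw [hrest, h]
      refine (abs_pow_three_le_resonance (j := l) hk hj hm (by lia) (by lia) (by lia)).trans_eq ?_
      ring
    · have hrest : a₂ * a₃ * a₄ = |l| * |k| * |j| :=
        mul_left_cancel₀ ha₁.ne' (by rw [hprod, h]; ring)
      rw [hrest, h]
      refine (abs_pow_three_le_resonance (j := m) hl hk hj (by lia) (by lia) (by lia)).trans_eq ?_
      ring
  generalize j ^ 2 - k ^ 2 + l ^ 2 - m ^ 2 = w at key ⊢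
  have hR : (0 : ℝ) < (a₂ : ℝ) * a₃ * a₄ := by exact_mod_cast mul_pos (mul_pos ha₂ ha₃) ha₄
  have keyR : (a₁ : ℝ) ^ 3 ≤ 4 * (w : ℝ) ^ 2 * ((a₂ : ℝ) * a₃ * a₄) := by exact_mod_cast key
  have ha₁R : (0 : ℝ) ≤ a₁ := by exact_mod_cast ha₁.le
  rw [ge_iff_le, div_le_iff₀ (by positivity), Int.cast_abs]
  refine (pow_le_pow_iff_left₀ (by positivity) (by positivity) two_ne_zero).1 ?_
  calc (√(a₁ : ℝ) ^ 3) ^ 2 = (√(a₁ : ℝ) ^ 2) ^ 3 := by ring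
    _ = (a₁ : ℝ) ^ 3 := by rw [Real.sq_sqrt ha₁R]
    _ ≤ 4 * (w : ℝ) ^ 2 * ((a₂ : ℝ) * a₃ * a₄) := keyR
    _ = (|(w : ℝ)| * (2 * √((a₂ : ℝ) * a₃ * a₄))) ^ 2 := by
      rw [mul_pow, mul_pow, sq_abs, Real.sq_sqrt hR.le]
      ring
end

section
/- Let j₁, j₂, j₃, j₄, j₅, j₆ be nonzero integers with j₁ - j₂ + j₃ - j₄ + j₅ - j₆ = 0 and j₁² - j₂² + j₃² - j₄² + j₅² - j₆² ≠ 0, and suppose |j₁| ≥ |j₃| ≥ |j₅|, |j₂| ≥ |j₄| ≥ |j₆| and |j₁| ≥ |j₂|. Let j₁* ≥ j₂* ≥ j₃* ≥ j₄* ≥ j₅* ≥ j₆* denote the decreasing rearrangement of the six absolute values |j₁|, ..., |j₆|. If it is not the case that both j₁ = j₂ and j₁* > 100·(j₃*)², then |j₁² - j₂² + j₃² - j₄² + j₅² - j₆²| ≥ (j₁*)³ / (100·(j₂* · j₃* · j₄* · j₅* · j₆*)²). -/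
/-- Two permutation-equivalent lists whose heads dominate their tails have equal heads and
permutation-equivalent tails. -/
theorem List.Perm.head_eq_and_tail_of_forall_le {α : Type*} [PartialOrder α] {x y : α}
    {l m : List α} (h : (x :: l).Perm (y :: m)) (hx : ∀ z ∈ l, z ≤ x) (hy : ∀ z ∈ m, z ≤ y) :
    x = y ∧ l.Perm m := by
  have hxy : x = y := by
    apply le_antisymm
    · rcases List.mem_cons.1 (h.subset List.mem_cons_self) with e | e
      · exact e.le
      · exact hy x e
    · rcases List.mem_cons.1 (h.symm.subset List.mem_cons_self) with e | e
      · exact e.le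
      · exact hx y e
  subst hxy
  exact ⟨rfl, h.cons_inv⟩

/-- The cubic bound on `a₁` in terms of the divisor `D`, in each of the three regimes. -/
theorem cube_le_mul_sq_of_regime {a₁ a₂ a₃ P D : ℤ} (h₁ : 0 < a₁) (hD : 0 < D) (hP : 0 < P)
    (h₃ : 0 < a₃) (h12 : a₁ ≤ 5 * a₂)
    (h : a₁ ≤ 4 * a₃ ^ 2 ∨ a₁ ≤ 4 * D ∨ a₁ = a₂ ∧ a₁ ≤ 100 * a₃ ^ 2) :
    a₁ ^ 3 ≤ D * (100 * (a₂ * a₃ * P) ^ 2) := by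
  have hP2 : 1 ≤ P ^ 2 := one_le_pow₀ hP
  have ha3 : 1 ≤ a₃ ^ 2 := one_le_pow₀ h₃
  have hsq : a₁ ^ 2 ≤ 25 * a₂ ^ 2 := by nlinarith
  have ha2 : 0 ≤ a₂ ^ 2 := sq_nonneg _
  have hcube : a₁ ^ 3 ≤ 100 * (a₂ ^ 2 * (D * a₃ ^ 2)) := by
    rcases h with h | h | ⟨rfl, h⟩
    · have : a₁ ≤ 4 * (D * a₃ ^ 2) := by nlinarith
      nlinarith [mul_le_mul hsq this h₁.le (by positivity)]
    · have : a₁ ≤ 4 * (D * a₃ ^ 2) := by nlinarith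
      nlinarith [mul_le_mul hsq this h₁.le (by positivity)]
    · have : a₁ ≤ 100 * (D * a₃ ^ 2) := by nlinarith
      nlinarith [mul_le_mul_of_nonneg_left this ha2]
  calc a₁ ^ 3 ≤ 100 * (a₂ ^ 2 * (D * a₃ ^ 2)) * 1 := by rwa [mul_one]
    _ ≤ 100 * (a₂ ^ 2 * (D * a₃ ^ 2)) * P ^ 2 :=
        mul_le_mul_of_nonneg_left hP2 (by positivity)
    _ = D * (100 * (a₂ * a₃ * P) ^ 2) := by ring

/-- If `|j₁| > |j₂|`, then `j₁² - j₂²` is at least `|j₁|`. -/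
theorem abs_le_sq_sub_sq_of_abs_lt_abs {j₁ j₂ : ℤ} (h : |j₂| < |j₁|) :
    |j₁| ≤ j₁ ^ 2 - j₂ ^ 2 := by
  rw [← sq_abs j₁, ← sq_abs j₂]
  nlinarith [abs_nonneg j₂]

/-- Lemma 2.2: lower bound on the divisor for sextic non-resonant indices,
except in the case j₁ = j₂ and j₁* > 100 (j₃*)². The decreasing rearrangement
a₁ ≥ a₂ ≥ ... ≥ a₆ of |j₁|, ..., |j₆| is encoded by a sorted permutation. -/
theorem stmt_4 (j₁ j₂ j₃ j₄ j₅ j₆ : ℤ)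
    (h₁ : j₁ ≠ 0) (h₂ : j₂ ≠ 0) (h₃ : j₃ ≠ 0) (h₄ : j₄ ≠ 0) (h₅ : j₅ ≠ 0) (h₆ : j₆ ≠ 0)
    (hmom : j₁ - j₂ + j₃ - j₄ + j₅ - j₆ = 0)
    (hres : j₁ ^ 2 - j₂ ^ 2 + j₃ ^ 2 - j₄ ^ 2 + j₅ ^ 2 - j₆ ^ 2 ≠ 0)
    (h13 : |j₃| ≤ |j₁|) (h35 : |j₅| ≤ |j₃|) (h24 : |j₄| ≤ |j₂|) (h46 : |j₆| ≤ |j₄|)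
    (h12 : |j₂| ≤ |j₁|)
    (a₁ a₂ a₃ a₄ a₅ a₆ : ℤ)
    (hperm : [a₁, a₂, a₃, a₄, a₅, a₆].Perm [|j₁|, |j₂|, |j₃|, |j₄|, |j₅|, |j₆|])
    (hs12 : a₂ ≤ a₁) (hs23 : a₃ ≤ a₂) (hs34 : a₄ ≤ a₃) (hs45 : a₅ ≤ a₄) (hs56 : a₆ ≤ a₅)
    (hexc : ¬(j₁ = j₂ ∧ a₁ > 100 * a₃ ^ 2)) :
    ((|j₁ ^ 2 - j₂ ^ 2 + j₃ ^ 2 - j₄ ^ 2 + j₅ ^ 2 - j₆ ^ 2| : ℤ) : ℝ) ≥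
      (a₁ : ℝ) ^ 3 / (100 * ((a₂ : ℝ) * (a₃ : ℝ) * (a₄ : ℝ) * (a₅ : ℝ) * (a₆ : ℝ)) ^ 2) := by
  have hle5 : |j₁| ≤ |j₂| + |j₃| + |j₄| + |j₅| + |j₆| := by
    grind
  obtain ⟨ha₁, hperm₂⟩ := hperm.head_eq_and_tail_of_forall_le
    (by simp only [List.forall_mem_cons, List.not_mem_nil, false_imp_iff, implies_true,
        and_true]; omega)
    (by simp only [List.forall_mem_cons, List.not_mem_nil, false_imp_iff, implies_true,
        and_true]; omega)
  have hpos : ∀ z ∈ [a₂, a₃, a₄, a₅, a₆], 0 < z := by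
    intro z hz
    have := hperm₂.subset hz
    simp only [List.mem_cons, List.not_mem_nil, or_false] at this
    rcases this with rfl | rfl | rfl | rfl | rfl <;> simpa
  simp only [List.forall_mem_cons, List.not_mem_nil, false_imp_iff, implies_true,
    and_true] at hpos
  obtain ⟨p₂, p₃, p₄, p₅, p₆⟩ := hpos
  have sq_le : ∀ {j : ℤ}, |j| ≤ a₃ → j ^ 2 ≤ a₃ ^ 2 := fun h => by
    rw [← sq_abs]; exact pow_le_pow_left₀ (abs_nonneg _) h 2
  set D := j₁ ^ 2 - j₂ ^ 2 + j₃ ^ 2 - j₄ ^ 2 + j₅ ^ 2 - j₆ ^ 2 with hD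
  have hmain : a₁ ≤ 5 * a₂ ∧
      (a₁ ≤ 4 * a₃ ^ 2 ∨ a₁ ≤ 4 * |D| ∨ a₁ = a₂ ∧ a₁ ≤ 100 * a₃ ^ 2) := by
    have ha₃ : a₃ ≤ a₃ ^ 2 := by nlinarith
    rcases le_or_gt |j₃| |j₂| with h23 | h23
    · obtain ⟨ha₂, hperm₃⟩ := hperm₂.head_eq_and_tail_of_forall_le
        (by simp only [List.forall_mem_cons, List.not_mem_nil, false_imp_iff, implies_true,
        and_true]; omega)
        (by simp only [List.forall_mem_cons, List.not_mem_nil, false_imp_iff, implies_true,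
        and_true]; omega)
      have hle : ∀ z ∈ [|j₃|, |j₄|, |j₅|, |j₆|], z ≤ a₃ := by
        intro z hz
        have := hperm₃.symm.subset hz
        simp only [List.mem_cons, List.not_mem_nil, or_false] at this
        omega
      simp only [List.forall_mem_cons, List.not_mem_nil, false_imp_iff, implies_true,
        and_true] at hle
      obtain ⟨l₃, l₄, l₅, l₆⟩ := hle
      refine ⟨by omega, ?_⟩
      by_cases he : j₁ = j₂
      · right; right
        exact ⟨by rw [ha₁, ha₂, he], not_lt.1 fun h => hexc ⟨he, h⟩⟩
      by_cases hn : j₁ = -j₂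
      · left
        grind
      have hlt : |j₂| < |j₁| := lt_of_le_of_ne h12 fun h => by
        rcases abs_eq_abs.1 h with h | h <;> omega
      have := abs_le_sq_sub_sq_of_abs_lt_abs hlt
      by_cases hbig : a₁ ≤ 4 * a₃ ^ 2
      · exact Or.inl hbig
      right; left
      have := sq_le l₄
      have := sq_le l₆
      have := le_abs_self D
      linarith [sq_nonneg j₃, sq_nonneg j₅]
    · obtain ⟨ha₂, hperm₃⟩ := (hperm₂.trans (List.Perm.swap _ _ _)).head_eq_and_tail_of_forall_le
        (by simp only [List.forall_mem_cons, List.not_mem_nil, false_imp_iff, implies_true,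
        and_true]; omega)
        (by simp only [List.forall_mem_cons, List.not_mem_nil, false_imp_iff, implies_true,
        and_true]; omega)
      have hle : |j₂| ≤ a₃ := by
        have := hperm₃.symm.subset List.mem_cons_self
        simp only [List.mem_cons, List.not_mem_nil, or_false] at this
        omega
      refine ⟨by omega, ?_⟩
      by_cases hbig : a₁ ≤ 4 * a₃ ^ 2
      · exact Or.inl hbig
      right; left
      have := sq_le hle
      have := sq_le (h24.trans hle)
      have := sq_le (h46.trans (h24.trans hle))
      have := le_abs_self D
      have hsq : j₁ ^ 2 = a₁ ^ 2 := by rw [ha₁, sq_abs]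
      have : 5 * a₁ ≤ a₁ ^ 2 := by
        rw [sq]; exact mul_le_mul_of_nonneg_right (by omega) (by omega)
      linarith [sq_nonneg j₃, sq_nonneg j₅]
  have hDpos : 0 < |D| := abs_pos.2 hres
  have hfin := cube_le_mul_sq_of_regime (P := a₄ * a₅ * a₆) (p₂.trans_le hs12) hDpos
    (by positivity) p₃ hmain.1 hmain.2
  rw [ge_iff_le]
  have q : ∀ {a : ℤ}, 0 < a → (0 : ℝ) < a := fun h => by exact_mod_cast h
  have := q p₂
  have := q p₃
  have := q p₄
  have := q p₅
  have := q p₆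
  rw [div_le_iff₀ (by positivity)]
  rw [show a₂ * a₃ * (a₄ * a₅ * a₆) = a₂ * a₃ * a₄ * a₅ * a₆ by ring] at hfin
  exact_mod_cast hfin
end

section
/- Define μ(x,y,z) = 1 / ((x - y)(z - y)) for real numbers x, y, z with x ≠ y and z ≠ y. Let x₁, x₂, x₃, y₁, y₂, y₃ be real numbers such that x_α ≠ y_β for all α, β ∈ {1,2,3}, x₁ + x₂ + x₃ = y₁ + y₂ + y₃, and x₁² + x₂² + x₃² = y₁² + y₂² + y₃². Then the sum of μ(x_α, y_β, x_γ) over all pairs {α < γ} ⊂ {1,2,3} and all β ∈ {1,2,3} (nine terms in total) equals 0. -/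
/-- μ(x,y,z) = 1/((x - y)(z - y)). -/
noncomputable def mu (x y z : ℝ) : ℝ := 1 / ((x - y) * (z - y))

theorem mu_add_mu_add_mu {a b c y : ℝ} (ha : a ≠ y) (hb : b ≠ y) (hc : c ≠ y) :
    mu a y b + mu a y c + mu b y c =
      (a + b + c - 3 * y) / ((a - y) * (b - y) * (c - y)) := by
  have ha := sub_ne_zero.2 ha
  have hb := sub_ne_zero.2 hb
  have hc := sub_ne_zero.2 hc
  unfold mu
  field_simp
  ring

/-- Two monic cubics with roots sharing their first two power sums differ by a constant. -/
theorem prod_sub_eq_of_power_sums_eq {a b c u v w : ℝ} (hsum : a + b + c = u + v + w)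
    (hsq : a ^ 2 + b ^ 2 + c ^ 2 = u ^ 2 + v ^ 2 + w ^ 2) (t : ℝ) :
    (a - t) * (b - t) * (c - t) =
      a * b * c - u * v * w + (u - t) * (v - t) * (w - t) := by
  linear_combination (t ^ 2 - t * (a + b + c + u + v + w) / 2) * hsum + t / 2 * hsq

/-- Lemma 3.1 (first identity): the sum of the nine terms μ(x_α, y_β, x_γ)
over {α < γ} ⊂ {1,2,3}, β ∈ {1,2,3} vanishes. -/
theorem stmt_6 (x₁ x₂ x₃ y₁ y₂ y₃ : ℝ)
    (h11 : x₁ ≠ y₁) (h12 : x₁ ≠ y₂) (h13 : x₁ ≠ y₃)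
    (h21 : x₂ ≠ y₁) (h22 : x₂ ≠ y₂) (h23 : x₂ ≠ y₃)
    (h31 : x₃ ≠ y₁) (h32 : x₃ ≠ y₂) (h33 : x₃ ≠ y₃)
    (hsum : x₁ + x₂ + x₃ = y₁ + y₂ + y₃)
    (hsq : x₁ ^ 2 + x₂ ^ 2 + x₃ ^ 2 = y₁ ^ 2 + y₂ ^ 2 + y₃ ^ 2) :
    (mu x₁ y₁ x₂ + mu x₁ y₁ x₃ + mu x₂ y₁ x₃) +
      (mu x₁ y₂ x₂ + mu x₁ y₂ x₃ + mu x₂ y₂ x₃) +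
      (mu x₁ y₃ x₂ + mu x₁ y₃ x₃ + mu x₂ y₃ x₃) = 0 := by
  have hprod := prod_sub_eq_of_power_sums_eq hsum hsq
  rw [mu_add_mu_add_mu h11 h21 h31, mu_add_mu_add_mu h12 h22 h32,
    mu_add_mu_add_mu h13 h23 h33, hprod y₁, hprod y₂, hprod y₃]
  simp only [sub_self, zero_mul, mul_zero, add_zero]
  rw [← add_div, ← add_div, div_eq_zero_iff]
  left
  linear_combination 3 * hsum
end

section
/- Define τ(x,y,z) = (x - y + z) / ((x - y)(z - y)) for real numbers x, y, z with x ≠ y and z ≠ y. Let x₁, x₂, x₃, y₁, y₂, y₃ be real numbers such that x_α ≠ y_β for all α, β ∈ {1,2,3}, x₁ + x₂ + x₃ = y₁ + y₂ + y₃, and x₁² + x₂² + x₃² = y₁² + y₂² + y₃². Then the sum of τ(x_α, y_β, x_γ) over all pairs {α < γ} ⊂ {1,2,3} and all β ∈ {1,2,3} (nine terms in total) equals 0. -/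
/-- τ(x,y,z) = (x - y + z)/((x - y)(z - y)). -/
noncomputable def tau (x y z : ℝ) : ℝ := (x - y + z) / ((x - y) * (z - y))

theorem tau_pairs_sum (a b c y : ℝ) (ha : a ≠ y) (hb : b ≠ y) (hc : c ≠ y) :
    tau a y b + tau a y c + tau b y c =
      ((a + b + c) ^ 2 - 3 * (a + b + c) * y - (a ^ 2 + b ^ 2 + c ^ 2) + 3 * y ^ 2) /
        ((a - y) * (b - y) * (c - y)) := by
  have := sub_ne_zero.mpr ha
  have := sub_ne_zero.mpr hb
  have := sub_ne_zero.mpr hc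
  unfold tau
  field_simp
  ring

/-- If two triples have the same sum and the same sum of squares, the monic cubics they define
differ by a constant. -/
theorem prod_sub_eq_of_sum_eq_of_sum_sq_eq (a b c u v w : ℝ) (h : a + b + c = u + v + w)
    (h2 : a ^ 2 + b ^ 2 + c ^ 2 = u ^ 2 + v ^ 2 + w ^ 2) (t : ℝ) :
    (a - t) * (b - t) * (c - t) = (u - t) * (v - t) * (w - t) + (a * b * c - u * v * w) := by
  linear_combination (t ^ 2 - t * (a + b + c + u + v + w) / 2) * h + t / 2 * h2

/-- Lemma 3.1 (second identity): the sum of the nine terms τ(x_α, y_β, x_γ)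
over {α < γ} ⊂ {1,2,3}, β ∈ {1,2,3} vanishes. -/
theorem stmt_7 (x₁ x₂ x₃ y₁ y₂ y₃ : ℝ)
    (h11 : x₁ ≠ y₁) (h12 : x₁ ≠ y₂) (h13 : x₁ ≠ y₃)
    (h21 : x₂ ≠ y₁) (h22 : x₂ ≠ y₂) (h23 : x₂ ≠ y₃)
    (h31 : x₃ ≠ y₁) (h32 : x₃ ≠ y₂) (h33 : x₃ ≠ y₃)
    (hsum : x₁ + x₂ + x₃ = y₁ + y₂ + y₃)
    (hsq : x₁ ^ 2 + x₂ ^ 2 + x₃ ^ 2 = y₁ ^ 2 + y₂ ^ 2 + y₃ ^ 2) :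
    (tau x₁ y₁ x₂ + tau x₁ y₁ x₃ + tau x₂ y₁ x₃) +
      (tau x₁ y₂ x₂ + tau x₁ y₂ x₃ + tau x₂ y₂ x₃) +
      (tau x₁ y₃ x₂ + tau x₁ y₃ x₃ + tau x₂ y₃ x₃) = 0 := by
  have hprod := prod_sub_eq_of_sum_eq_of_sum_sq_eq x₁ x₂ x₃ y₁ y₂ y₃ hsum hsq
  rw [tau_pairs_sum x₁ x₂ x₃ y₁ h11 h21 h31, tau_pairs_sum x₁ x₂ x₃ y₂ h12 h22 h32,
    tau_pairs_sum x₁ x₂ x₃ y₃ h13 h23 h33, hprod y₁, hprod y₂, hprod y₃]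
  simp only [sub_self, zero_mul, mul_zero, zero_add]
  rw [← add_div, ← add_div, hsum, hsq, div_eq_zero_iff]
  left
  ring
end

section
/- Let a ≥ b ≥ c be positive real numbers, let r ≥ 1 be an integer, and let s ≥ 1 be a real number. If a - b < 2rc and a < 2rb, then a^{2s+1} - b^{2s+1} ≤ (2s+1)·(2r)^{s+1}·a^s·b^s·c. -/
/-- The tangent-line bound for the convex function `x ↦ x ^ p`, `p ≥ 1`. -/
theorem Real.rpow_sub_rpow_le_mul_rpow_sub_one {a b p : ℝ} (ha : 0 < a) (hb : 0 ≤ b)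
    (hp : 1 ≤ p) : a ^ p - b ^ p ≤ p * a ^ (p - 1) * (a - b) := by
  have bernoulli : 1 + p * (b / a - 1) ≤ (1 + (b / a - 1)) ^ p :=
    one_add_mul_self_le_rpow_one_add (by linarith [div_nonneg hb ha.le]) hp
  rw [add_sub_cancel, Real.div_rpow hb ha.le, le_div_iff₀ (Real.rpow_pos_of_pos ha p)]
    at bernoulli
  have hpow : a ^ p = a ^ (p - 1) * a := by
    rw [← Real.rpow_add_one ha.ne', sub_add_cancel]
  have hexpand : (1 + p * (b / a - 1)) * a ^ p = a ^ p - p * a ^ (p - 1) * (a - b) := by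
    rw [hpow]
    field_simp
    ring
  linarith

/-- If a ≥ b ≥ c > 0, r ≥ 1 an integer, s ≥ 1 real, a - b < 2rc and a < 2rb, then
a^{2s+1} - b^{2s+1} ≤ (2s+1)(2r)^{s+1} a^s b^s c. -/
theorem stmt_13 (a b c : ℝ) (hc : 0 < c) (hcb : c ≤ b) (hba : b ≤ a)
    (r : ℕ) (hr : 1 ≤ r) (s : ℝ) (hs : 1 ≤ s)
    (h₁ : a - b < 2 * r * c) (h₂ : a < 2 * r * b) :
    a ^ (2 * s + 1) - b ^ (2 * s + 1) ≤
      (2 * s + 1) * ((2 * r : ℕ) : ℝ) ^ (s + 1) * a ^ s * b ^ s * c := by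
  have hb : 0 < b := hc.trans_le hcb
  have ha : 0 < a := hb.trans_le hba
  have hr0 : (0 : ℝ) < 2 * r := by positivity
  push_cast
  calc a ^ (2 * s + 1) - b ^ (2 * s + 1)
      ≤ (2 * s + 1) * a ^ (2 * s + 1 - 1) * (a - b) :=
        Real.rpow_sub_rpow_le_mul_rpow_sub_one ha hb.le (by linarith)
    _ = (2 * s + 1) * (a ^ s * a ^ s) * (a - b) := by
        rw [← Real.rpow_add ha, add_sub_cancel_right, two_mul]
    _ ≤ (2 * s + 1) * (a ^ s * (2 * r * b) ^ s) * (2 * r * c) := by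
        have := sub_nonneg.2 hba
        gcongr
    _ = (2 * s + 1) * (2 * r : ℝ) ^ (s + 1) * a ^ s * b ^ s * c := by
        rw [Real.mul_rpow hr0.le hb.le, Real.rpow_add_one hr0.ne']
        ring
end
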